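/- Let P be a shift-invariant probability measure on Δ^ℤ that is a convex combination P = Σ_{k=1}^n λ_k P_k of distinct ergodic measures P_1,…,P_n with λ_k > 0. Then dim(P) = Σ_{k=1}^n dim(P_k), where dim denotes the dimension of the canonical OOM vector space. -/

import Mathlib

open MeasureTheory ProbabilityTheory Filter Topology

variable {Δ : Type*} [Fintype Δ] [MeasurableSpace Δ] [MeasurableSingletonClass Δ]
  [TopologicalSpace Δ] [DiscreteTopology Δ]

/-- The `n`-fold one-sided shift on `Δ^ℕ`. -/
def shiftN (n : ℕ) : (ℕ → Δ) → (ℕ → Δ) := fun x k => x (k + n)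

/-- The cylinder set `[w]` in `Δ^ℕ`. -/
def cylN {n : ℕ} (w : Fin n → Δ) : Set (ℕ → Δ) := {x | ∀ i : Fin n, x (i : ℕ) = w i}

/-- The future `X_ℕ = (X_1, X_2, …)` of a two-sided trajectory. -/
def futureMap : (ℤ → Δ) → (ℕ → Δ) := fun ω n => ω ((n : ℤ) + 1)

/-- The past `(X_0, X_{-1}, …)` of a two-sided trajectory. -/
def pastMap : (ℤ → Δ) → (ℕ → Δ) := fun ω n => ω (-(n : ℤ))

/-- The σ-algebra generated by the past coordinates `X_k`, `k ≤ 0`. -/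
def pastSA (Δ : Type*) [MeasurableSpace Δ] : MeasurableSpace (ℤ → Δ) :=
  MeasurableSpace.comap pastMap MeasurableSpace.pi

/-- `P_ℕ = P ∘ X_ℕ⁻¹`. -/
noncomputable def Pnat (P : Measure (ℤ → Δ)) : Measure (ℕ → Δ) := P.map futureMap

/-- `τ_w(Q)(B) = Q([w] ∩ σ^{-n} B)`. -/
noncomputable def tauMeas (Q : Measure (ℕ → Δ)) {n : ℕ} (w : Fin n → Δ) : Measure (ℕ → Δ) :=
  (Q.restrict (cylN w)).map (shiftN n)

/-- The weak*-realization of a finite measure: the functional `f ↦ ∫ f dμ` on continuous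
functions.  The space `C(X,ℝ) → ℝ` carries the topology of pointwise convergence, so that
convergence of these functionals is exactly weak* convergence of the measures. -/
noncomputable def funcOf {X : Type*} [TopologicalSpace X] [MeasurableSpace X]
    (μ : Measure X) : C(X, ℝ) → ℝ :=
  fun f => ∫ x, f x ∂μ

/-- The canonical OOM vector space `V_P`: the span of the functionals of the measures
`τ_w(P_ℕ)` over all finite words `w` (including the empty word). -/
noncomputable def VP (P : Measure (ℤ → Δ)) : Submodule ℝ (C((ℕ → Δ), ℝ) → ℝ) :=
  Submodule.span ℝ {g | ∃ (n : ℕ) (w : Fin n → Δ), g = funcOf (tauMeas (Pnat P) w)}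

/-- The two-sided shift on `Δ^ℤ`. -/
def shiftZ : (ℤ → Δ) → (ℤ → Δ) := fun x k => x (k + 1)

set_option linter.unusedSectionVars false

/-- Ergodic averages of an `L²` function converge weakly to its mean. -/
theorem Ergodic.tendsto_average_integral_mul {α : Type*} [MeasurableSpace α] {μ : Measure α}
    [IsProbabilityMeasure μ] {T : α → α} (hT : Ergodic T μ) {f g : α → ℝ}
    (hf : MemLp f 2 μ) (hg : MemLp g 2 μ) :
    Tendsto (fun N : ℕ => (N : ℝ)⁻¹ * ∑ i ∈ Finset.range N, ∫ x, g x * f (T^[i] x) ∂μ)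
      atTop (𝓝 ((∫ x, g x ∂μ) * ∫ x, f x ∂μ)) := by
  have hTm := hT.toMeasurePreserving
  let U : Lp ℝ 2 μ →L[ℝ] Lp ℝ 2 μ :=
    (Lp.compMeasurePreservingₗᵢ (E := ℝ) (p := 2) ℝ T hTm).toContinuousLinearMap
  have hU : ‖U‖ ≤ 1 := LinearIsometry.norm_toContinuousLinearMap_le _
  have hlim := U.tendsto_birkhoffAverage_orthogonalProjection hU (hf.toLp f)
  set y := (U.eqLocus (1 : Lp ℝ 2 μ →L[ℝ] Lp ℝ 2 μ)).orthogonalProjectionOnto (hf.toLp f) with hy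
  have hone : MemLp (fun _ : α => (1 : ℝ)) 2 μ := memLp_const 1
  have hinner : ∀ {u v : α → ℝ} (hu : MemLp u 2 μ) (hv : MemLp v 2 μ),
      inner ℝ (hu.toLp u) (hv.toLp v) = ∫ x, u x * v x ∂μ := by
    intro u v hu hv
    rw [L2.inner_def]
    refine integral_congr_ae ?_
    filter_upwards [hu.coeFn_toLp, hv.coeFn_toLp] with x h1 h2
    rw [h1, h2]
    simp [mul_comm]
  have hUone : hone.toLp _ ∈ U.eqLocus (1 : Lp ℝ 2 μ →L[ℝ] Lp ℝ 2 μ) := by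
    change Lp.compMeasurePreserving T hTm (hone.toLp _) = hone.toLp _
    rw [Lp.toLp_compMeasurePreserving]
    rfl
  have hyfix : Lp.compMeasurePreserving T hTm (y : Lp ℝ 2 μ) = y := y.2
  obtain ⟨c, hc⟩ := hT.ae_eq_const_of_ae_eq_comp_ae (Lp.aestronglyMeasurable (y : Lp ℝ 2 μ))
    ((Lp.coeFn_compMeasurePreserving _ hTm).symm.trans (by rw [hyfix]))
  have hyc : (y : Lp ℝ 2 μ) = (memLp_const c : MemLp (fun _ : α => c) 2 μ).toLp _ :=
    Lp.ext (hc.trans (MemLp.coeFn_toLp _).symm)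
  have hcf : c = ∫ x, f x ∂μ := by
    have h := Submodule.starProjection_inner_eq_zero (K := U.eqLocus (1 : Lp ℝ 2 μ →L[ℝ] Lp ℝ 2 μ))
      (hf.toLp f) _ hUone
    rw [Submodule.starProjection_apply, ← hy, hyc, inner_sub_left, hinner, hinner] at h
    simp at h
    linarith
  have hinn := (Filter.Tendsto.inner (𝕜 := ℝ) (tendsto_const_nhds (x := hg.toLp g)) hlim)
  rw [hyc, hinner, integral_mul_const, hcf] at hinn
  refine hinn.congr fun N => ?_
  rw [birkhoffAverage, birkhoffSum, inner_smul_right, inner_sum]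
  refine congrArg _ (Finset.sum_congr rfl fun i _ => ?_)
  have hit : U^[i] (hf.toLp f) = (hf.comp_measurePreserving (hTm.iterate i)).toLp _ := by
    rw [← Lp.toLp_compMeasurePreserving hf (hTm.iterate i), ← Lp.compMeasurePreserving_iterate]
    rfl
  rw [id, hit, hinner]
  rfl

/-- A subspace of a finite power stable under multipliers which separate the coordinates
contains the coordinate components of its elements. -/
theorem Submodule.single_mem_of_separating {ι F E : Type*} [Fintype ι] [DecidableEq ι]
    [AddCommGroup E] [Module ℝ E] (M : Submodule ℝ (ι → E)) (a : F → ι → ℝ)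
    (hM : ∀ f, ∀ ψ ∈ M, (fun k => a f k • ψ k) ∈ M)
    (hsep : ∀ j k, j ≠ k → ∃ f, a f j ≠ a f k) {ψ : ι → E} (hψ : ψ ∈ M) (k : ι) :
    Pi.single k (ψ k) ∈ M := by
  have main : ∀ s : Finset ι, k ∉ s → ∃ φ ∈ M, φ k = ψ k ∧ ∀ j ∈ s, φ j = 0 := by
    intro s
    induction s using Finset.induction_on with
    | empty => exact fun _ => ⟨ψ, hψ, rfl, by simp⟩
    | insert j s _ ih =>
      intro hk
      simp only [Finset.mem_insert, not_or] at hk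
      obtain ⟨φ, hφ, hφk, hφs⟩ := ih hk.2
      obtain ⟨f, hf⟩ := hsep k j hk.1
      refine ⟨(a f k - a f j)⁻¹ • ((fun k => a f k • φ k) - a f j • φ),
        M.smul_mem _ (M.sub_mem (hM f φ hφ) (M.smul_mem _ hφ)), ?_, ?_⟩
      · simp [← sub_smul, smul_smul, hφk, inv_mul_cancel₀ (sub_ne_zero.2 hf)]
      · intro i hi
        rcases Finset.mem_insert.1 hi with rfl | hi
        · simp
        · simp [hφs i hi]
  obtain ⟨φ, hφ, hφk, hφs⟩ := main (Finset.univ.erase k) (by simp)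
  convert hφ using 1
  ext j
  by_cases hj : j = k
  · subst hj; simp [hφk]
  · simp [hj, hφs j (by simp [hj])]

/-- The indicator of a cylinder set as a continuous function. -/
noncomputable def cylIndicator {n : ℕ} (w : Fin n → Δ) : C(ℕ → Δ, ℝ) where
  toFun := (cylN w).indicator 1
  continuous_toFun := by
    refine IsClopen.continuous_indicator ?_ continuous_one
    have : cylN w = (fun (x : ℕ → Δ) (i : Fin n) => x i) ⁻¹' {w} := by
      ext x; simp [cylN, funext_iff]
    rw [this]
    exact (isClopen_discrete _).preimage (by fun_prop)

/-- The one-sided shift as a continuous map. -/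
def shiftC (n : ℕ) : C(ℕ → Δ, ℕ → Δ) where
  toFun := shiftN n
  continuous_toFun := by unfold shiftN; fun_prop

/-- The operator on functionals dual to `f ↦ h · f ∘ σⁿ`. -/
noncomputable def weightedShift (h : C(ℕ → Δ, ℝ)) (n : ℕ) :
    (C(ℕ → Δ, ℝ) → ℝ) →ₗ[ℝ] (C(ℕ → Δ, ℝ) → ℝ) :=
  LinearMap.funLeft ℝ ℝ fun f => h * f.comp (shiftC n)

theorem weightedShift_apply (h : C(ℕ → Δ, ℝ)) (n : ℕ) (ψ : C(ℕ → Δ, ℝ) → ℝ) (f : C(ℕ → Δ, ℝ)) :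
    weightedShift h n ψ f = ψ (h * f.comp (shiftC n)) := rfl

theorem cylIndicator_append {m n : ℕ} (w : Fin m → Δ) (v : Fin n → Δ) :
    cylIndicator (Fin.append w v) = cylIndicator w * (cylIndicator v).comp (shiftC m) := by
  ext x
  have : x ∈ cylN (Fin.append w v) ↔ x ∈ cylN w ∧ shiftN m x ∈ cylN v := by
    simp [cylN, shiftN, Fin.forall_fin_add, add_comm]
  by_cases h1 : x ∈ cylN w <;> by_cases h2 : shiftN m x ∈ cylN v <;>
    simp [cylIndicator, shiftC, Set.indicator, this, h1, h2]

theorem sum_cylIndicator (n : ℕ) : ∑ w : Fin n → Δ, cylIndicator w = 1 := by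
  classical
  ext x
  have : ∀ w : Fin n → Δ, x ∈ cylN w ↔ (fun i : Fin n => x i) = w := by
    simp [cylN, funext_iff]
  simp [cylIndicator, Set.indicator, this]

theorem shiftC_comp (m n : ℕ) :
    (shiftC m : C(ℕ → Δ, ℕ → Δ)).comp (shiftC n) = shiftC (m + n) := by
  ext x k
  simp [shiftC, shiftN, add_assoc]

theorem weightedShift_cylIndicator_comp {m n : ℕ} (w : Fin m → Δ) (v : Fin n → Δ)
    (ψ : C(ℕ → Δ, ℝ) → ℝ) :
    weightedShift (cylIndicator v) n (weightedShift (cylIndicator w) m ψ) =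
      weightedShift (cylIndicator (Fin.append w v)) (m + n) ψ := by
  ext f
  rw [weightedShift_apply, weightedShift_apply, weightedShift_apply, cylIndicator_append,
    add_comm m n, ← shiftC_comp, mul_assoc]
  rfl

theorem ContinuousMap.memLp_of_isFiniteMeasure (f : C(ℕ → Δ, ℝ)) (μ : Measure (ℕ → Δ))
    [IsFiniteMeasure μ] (p : ENNReal) : MemLp f p μ :=
  MemLp.of_bound f.continuous.aestronglyMeasurable ‖f‖ (ae_of_all _ f.norm_coe_le_norm)

theorem measurable_futureMap : Measurable (futureMap (Δ := Δ)) := by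
  unfold futureMap; fun_prop

instance (P : Measure (ℤ → Δ)) [IsFiniteMeasure P] : IsFiniteMeasure (Pnat P) := by
  unfold Pnat; infer_instance

theorem funcOf_tauMeas (Q : Measure (ℕ → Δ)) {n : ℕ} (w : Fin n → Δ) :
    funcOf (tauMeas Q w) = weightedShift (cylIndicator w) n (funcOf Q) := by
  ext f
  have hw : MeasurableSet (cylN w) := by
    have : cylN w = (fun (x : ℕ → Δ) (i : Fin n) => x i) ⁻¹' {w} := by
      ext x; simp [cylN, funext_iff]
    rw [this]
    exact measurableSet_preimage (by fun_prop) (measurableSet_singleton _)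
  rw [weightedShift_apply, funcOf, funcOf, tauMeas,
    integral_map (φ := shiftN n) (shiftC n).continuous.measurable.aemeasurable
      f.continuous.aestronglyMeasurable, ← integral_indicator hw]
  refine integral_congr_ae (ae_of_all _ fun x => ?_)
  by_cases hx : x ∈ cylN w <;> simp [cylIndicator, shiftC, hx]

theorem VP_eq_span (P : Measure (ℤ → Δ)) :
    VP P = Submodule.span ℝ
      {g | ∃ (n : ℕ) (w : Fin n → Δ), g = weightedShift (cylIndicator w) n (funcOf (Pnat P))} := by
  simp only [VP, funcOf_tauMeas]

theorem weightedShift_cylIndicator_mem_VP (P : Measure (ℤ → Δ)) {n : ℕ} (v : Fin n → Δ)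
    {ψ : C(ℕ → Δ, ℝ) → ℝ} (hψ : ψ ∈ VP P) : weightedShift (cylIndicator v) n ψ ∈ VP P := by
  rw [VP_eq_span] at *
  induction hψ using Submodule.span_induction with
  | mem _ h =>
    obtain ⟨m, w, rfl⟩ := h
    exact Submodule.subset_span ⟨_, _, weightedShift_cylIndicator_comp w v _⟩
  | zero => simp
  | add _ _ _ _ h1 h2 => rw [map_add]; exact add_mem h1 h2
  | smul c _ _ h => rw [map_smul]; exact Submodule.smul_mem _ c h

theorem sum_weightedShift_cylIndicator (P : Measure (ℤ → Δ)) [IsFiniteMeasure P] (n : ℕ)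
    {ψ : C(ℕ → Δ, ℝ) → ℝ} (hψ : ψ ∈ VP P) :
    ∑ v : Fin n → Δ, weightedShift (cylIndicator v) n ψ = weightedShift 1 n ψ := by
  rw [VP_eq_span] at hψ
  induction hψ using Submodule.span_induction with
  | mem _ h =>
    obtain ⟨m, w, rfl⟩ := h
    ext f
    simp only [Finset.sum_apply, weightedShift_apply, funcOf]
    rw [← integral_finsetSum _ fun v _ =>
      (ContinuousMap.memLp_of_isFiniteMeasure _ _ 1).integrable le_rfl, ← sum_cylIndicator n]
    refine integral_congr_ae (ae_of_all _ fun x => ?_)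
    simp [Finset.mul_sum, Finset.sum_mul]
  | zero => simp
  | add _ _ _ _ h1 h2 => simp only [map_add, Finset.sum_add_distrib, h1, h2]
  | smul c _ _ h => simp only [map_smul, ← Finset.smul_sum, h]

theorem weightedShift_one_mem_VP (P : Measure (ℤ → Δ)) [IsFiniteMeasure P] (n : ℕ)
    {ψ : C(ℕ → Δ, ℝ) → ℝ} (hψ : ψ ∈ VP P) : weightedShift 1 n ψ ∈ VP P := by
  rw [← sum_weightedShift_cylIndicator P n hψ]
  exact sum_mem fun v _ => weightedShift_cylIndicator_mem_VP P v hψ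

theorem shiftZ_iterate_apply (i : ℕ) (ω : ℤ → Δ) (k : ℤ) : shiftZ^[i] ω k = ω (k + i) := by
  induction i generalizing ω with
  | zero => simp
  | succ i ih =>
    rw [Function.iterate_succ_apply, ih, shiftZ]
    push_cast
    ring_nf

theorem futureMap_shiftZ_iterate (i : ℕ) (ω : ℤ → Δ) :
    futureMap (shiftZ^[i] ω) = shiftN i (futureMap ω) := by
  ext k
  simp only [shiftN, futureMap, shiftZ_iterate_apply]
  push_cast
  ring_nf

theorem funcOf_Pnat (P : Measure (ℤ → Δ)) (f : C(ℕ → Δ, ℝ)) :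
    funcOf (Pnat P) f = ∫ ω, f (futureMap ω) ∂P :=
  integral_map measurable_futureMap.aemeasurable f.continuous.aestronglyMeasurable

theorem funcOf_Pnat_comp_shiftC {P : Measure (ℤ → Δ)}
    (hP : MeasurePreserving (shiftZ (Δ := Δ)) P P) (n : ℕ) (f : C(ℕ → Δ, ℝ)) :
    funcOf (Pnat P) (f.comp (shiftC n)) = funcOf (Pnat P) f := by
  have h := hP.iterate n
  rw [funcOf_Pnat, funcOf_Pnat]
  conv_rhs => rw [← h.map_eq]
  rw [integral_map (f := fun ω => f (futureMap ω)) h.measurable.aemeasurable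
    (f.continuous.measurable.comp measurable_futureMap).aestronglyMeasurable]
  simp [futureMap_shiftZ_iterate, shiftC]

theorem tendsto_average_funcOf_Pnat {P : Measure (ℤ → Δ)} [IsProbabilityMeasure P]
    (hP : Ergodic (shiftZ (Δ := Δ)) P) (f g : C(ℕ → Δ, ℝ)) :
    Tendsto (fun N : ℕ => (N : ℝ)⁻¹ *
        ∑ i ∈ Finset.range N, funcOf (Pnat P) (g * f.comp (shiftC i)))
      atTop (𝓝 (funcOf (Pnat P) g * funcOf (Pnat P) f)) := by
  have hm : ∀ f : C(ℕ → Δ, ℝ), MemLp (fun ω => f (futureMap ω)) 2 P := fun f =>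
    (f.memLp_of_isFiniteMeasure (Pnat P) 2).comp_of_map measurable_futureMap.aemeasurable
  have := hP.tendsto_average_integral_mul (hm f) (hm g)
  simp only [futureMap_shiftZ_iterate] at this
  simp only [funcOf_Pnat]
  exact this

theorem tendsto_average_of_mem_VP {P : Measure (ℤ → Δ)} [IsProbabilityMeasure P]
    (hP : Ergodic (shiftZ (Δ := Δ)) P) (f g : C(ℕ → Δ, ℝ)) {ψ : C(ℕ → Δ, ℝ) → ℝ}
    (hψ : ψ ∈ VP P) :
    Tendsto (fun N : ℕ => (N : ℝ)⁻¹ * ∑ i ∈ Finset.range N, ψ (g * f.comp (shiftC i)))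
      atTop (𝓝 (ψ g * funcOf (Pnat P) f)) := by
  rw [VP_eq_span] at hψ
  induction hψ using Submodule.span_induction with
  | mem _ h =>
    obtain ⟨n, w, rfl⟩ := h
    have := tendsto_average_funcOf_Pnat hP (f.comp (shiftC n))
      (cylIndicator w * g.comp (shiftC n))
    rw [funcOf_Pnat_comp_shiftC hP.toMeasurePreserving] at this
    refine this.congr fun N => ?_
    refine congrArg _ (Finset.sum_congr rfl fun i _ => ?_)
    rw [weightedShift_apply, ContinuousMap.comp_assoc, shiftC_comp, add_comm n i, ← shiftC_comp,
      mul_assoc]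
    rfl
  | zero => simp
  | add _ _ _ _ h1 h2 =>
    simpa [Finset.sum_add_distrib, mul_add, add_mul] using h1.add h2
  | smul c _ _ h =>
    simpa [← Finset.mul_sum, mul_left_comm, mul_assoc] using h.const_mul c

/-- A shift-invariant measure is determined by its values on one-sided cylinders. -/
theorem eq_of_funcOf_cylIndicator_eq {P Q : Measure (ℤ → Δ)} [IsProbabilityMeasure P]
    [IsProbabilityMeasure Q] (hP : MeasurePreserving (shiftZ (Δ := Δ)) P P)
    (hQ : MeasurePreserving (shiftZ (Δ := Δ)) Q Q)
    (h : ∀ (n : ℕ) (w : Fin n → Δ),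
      funcOf (Pnat P) (cylIndicator w) = funcOf (Pnat Q) (cylIndicator w)) : P = Q := by
  let π (N : ℕ) (ω : ℤ → Δ) (i : Fin N) : Δ := futureMap ω i
  have hπ (N : ℕ) : Measurable (π N) :=
    measurable_pi_lambda _ fun i => (measurable_pi_apply (i : ℕ)).comp measurable_futureMap
  have hcyl (R : Measure (ℤ → Δ)) [IsProbabilityMeasure R] (N : ℕ) (w : Fin N → Δ) :
      funcOf (Pnat R) (cylIndicator w) = (R.map (π N)).real {w} := by
    have hs : MeasurableSet (π N ⁻¹' {w}) := hπ N (measurableSet_singleton w)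
    rw [funcOf_Pnat, map_measureReal_apply (hπ N) (measurableSet_singleton w),
      ← integral_indicator_one hs]
    refine integral_congr_ae (ae_of_all _ fun ω => ?_)
    have : futureMap ω ∈ cylN w ↔ ω ∈ π N ⁻¹' {w} := by simp [cylN, π, funext_iff]
    by_cases hω : ω ∈ π N ⁻¹' {w}
    · exact (Set.indicator_of_mem (this.2 hω) 1).trans (Set.indicator_of_mem hω 1).symm
    · exact (Set.indicator_of_notMem (mt this.1 hω) 1).trans (Set.indicator_of_notMem hω 1).symm
  have hmap (N : ℕ) : P.map (π N) = Q.map (π N) := by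
    have := Measure.isProbabilityMeasure_map (μ := P) (hπ N).aemeasurable
    have := Measure.isProbabilityMeasure_map (μ := Q) (hπ N).aemeasurable
    refine Measure.ext_of_singleton fun w => ?_
    have := h N w
    rw [hcyl, hcyl] at this
    exact (measureReal_eq_measureReal_iff).1 this
  have hmarg (I : Finset ℤ) : P.map I.restrict = Q.map I.restrict := by
    obtain ⟨m, hm⟩ : ∃ m : ℕ, ∀ i ∈ I, i.natAbs ≤ m := ⟨I.sup Int.natAbs, fun i hi =>
      Finset.le_sup (f := Int.natAbs) hi⟩
    let g (x : Fin (2 * m + 2) → Δ) (i : I) : Δ :=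
      x ⟨((i : ℤ) + m).toNat, by have := hm i i.2; omega⟩
    have hg : Measurable g := by fun_prop
    have hfun (ω : ℤ → Δ) : I.restrict (shiftZ^[m + 1] ω) = g (π (2 * m + 2) ω) := by
      ext i
      have := hm i i.2
      simp only [g, π, futureMap, Finset.restrict_def, shiftZ_iterate_apply]
      congr 1
      push_cast
      omega
    have hkey (R : Measure (ℤ → Δ)) (hR : MeasurePreserving (shiftZ (Δ := Δ)) R R) :
        R.map I.restrict = (R.map (π (2 * m + 2))).map g := by
      conv_lhs => rw [← (hR.iterate (m + 1)).map_eq]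
      rw [Measure.map_map (by fun_prop) (hR.iterate _).measurable, Measure.map_map hg (hπ _)]
      exact congrArg (R.map ·) (funext hfun)
    rw [hkey P hP, hkey Q hQ, hmap]
  have : ∀ I : Finset ℤ, IsFiniteMeasure (Q.map I.restrict) := fun I => inferInstance
  exact IsProjectiveLimit.unique (P := fun I => Q.map I.restrict) hmarg fun _ => rfl

theorem funcOf_Pnat_sum {n : ℕ} (Pk : Fin n → Measure (ℤ → Δ)) [∀ k, IsProbabilityMeasure (Pk k)]
    {l : Fin n → ℝ} (hl : ∀ k, 0 ≤ l k) :
    funcOf (Pnat (∑ k, ENNReal.ofReal (l k) • Pk k)) = ∑ k, l k • funcOf (Pnat (Pk k)) := by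
  ext f
  have hintegrable (k) : Integrable (fun ω => f (futureMap ω)) (Pk k) :=
    ((f.memLp_of_isFiniteMeasure (Pnat (Pk k)) 1).integrable le_rfl).comp_measurable
      measurable_futureMap
  rw [funcOf_Pnat, integral_finsetSum_measure fun k _ =>
    (hintegrable k).smul_measure ENNReal.ofReal_ne_top]
  simp [integral_smul_measure, ENNReal.toReal_ofReal (hl _), funcOf_Pnat]

theorem rank_VP_le_aleph0 (P : Measure (ℤ → Δ)) : Module.rank ℝ (VP P) ≤ Cardinal.aleph0 := by
  refine (rank_span_le _).trans (Cardinal.le_aleph0_iff_set_countable.2 ?_)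
  refine (Set.countable_range fun p : Σ n : ℕ, Fin n → Δ =>
    funcOf (tauMeas (Pnat P) p.2)).mono ?_
  rintro _ ⟨n, w, rfl⟩
  exact ⟨⟨n, w⟩, rfl⟩

theorem exists_funcOf_cylIndicator_ne {P Q : Measure (ℤ → Δ)} [IsProbabilityMeasure P]
    [IsProbabilityMeasure Q] (hP : MeasurePreserving (shiftZ (Δ := Δ)) P P)
    (hQ : MeasurePreserving (shiftZ (Δ := Δ)) Q Q) (hne : P ≠ Q) :
    ∃ p : Σ n : ℕ, Fin n → Δ,
      funcOf (Pnat P) (cylIndicator p.2) ≠ funcOf (Pnat Q) (cylIndicator p.2) := by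
  by_contra! h
  exact hne (eq_of_funcOf_cylIndicator_eq hP hQ fun n w => h ⟨n, w⟩)

/-- The canonical spaces of distinct ergodic measures are linearly independent. -/
theorem eq_zero_of_sum_eq_zero_of_mem_VP {n : ℕ} {Pk : Fin n → Measure (ℤ → Δ)}
    [∀ k, IsProbabilityMeasure (Pk k)] (herg : ∀ k, Ergodic (shiftZ (Δ := Δ)) (Pk k))
    (hinj : Function.Injective Pk) {ψ : Fin n → C(ℕ → Δ, ℝ) → ℝ} (hψ : ∀ k, ψ k ∈ VP (Pk k))
    (hsum : ∑ k, ψ k = 0) : ψ = 0 := by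
  let M : Submodule ℝ (Fin n → C(ℕ → Δ, ℝ) → ℝ) :=
    Submodule.pi Set.univ (fun k => VP (Pk k)) ⊓ LinearMap.ker (∑ k, LinearMap.proj k)
  have hmem {φ} : φ ∈ M ↔ (∀ k, φ k ∈ VP (Pk k)) ∧ ∑ k, φ k = 0 := by
    simp [M, Submodule.mem_pi]
  have h := M.single_mem_of_separating
    (fun (p : Σ n : ℕ, Fin n → Δ) k => funcOf (Pnat (Pk k)) (cylIndicator p.2)) ?_
    (fun j k hjk => exists_funcOf_cylIndicator_ne (herg j).toMeasurePreserving
      (herg k).toMeasurePreserving (hinj.ne hjk)) (hmem.2 ⟨hψ, hsum⟩)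
  · ext1 k
    simpa using (hmem.1 (h k)).2
  · intro p φ hφ
    rw [hmem] at hφ ⊢
    refine ⟨fun k => Submodule.smul_mem _ _ (hφ.1 k), ?_⟩
    ext g
    have hlim := tendsto_finsetSum Finset.univ fun k _ =>
      tendsto_average_of_mem_VP (herg k) (cylIndicator p.2) g (hφ.1 k)
    have hzero (f : C(ℕ → Δ, ℝ)) : ∑ k, φ k f = 0 := by
      simpa using congrFun hφ.2 f
    simp only [← Finset.mul_sum] at hlim
    simp only [Finset.sum_comm (s := Finset.univ), hzero, Finset.sum_const_zero, mul_zero] at hlim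
    simpa [mul_comm] using tendsto_nhds_unique hlim tendsto_const_nhds

/-- If the canonical space of a mixture is finite-dimensional, it contains the canonical spaces
of the ergodic components. -/
theorem VP_le_VP_of_finiteDimensional {n : ℕ} {Pk : Fin n → Measure (ℤ → Δ)}
    [∀ k, IsProbabilityMeasure (Pk k)] (herg : ∀ k, Ergodic (shiftZ (Δ := Δ)) (Pk k))
    (hinj : Function.Injective Pk) {l : Fin n → ℝ} (hl : ∀ k, 0 < l k)
    {P : Measure (ℤ → Δ)} [IsFiniteMeasure P] (hP : P = ∑ k, ENNReal.ofReal (l k) • Pk k)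
    [FiniteDimensional ℝ (VP P)] (k : Fin n) : VP (Pk k) ≤ VP P := by
  let e (k : Fin n) : C(ℕ → Δ, ℝ) → ℝ := funcOf (Pnat (Pk k))
  let M : Submodule ℝ (Fin n → ℝ) := (VP P).comap (Fintype.linearCombination ℝ e)
  have hmem {c} : c ∈ M ↔ ∑ k, c k • e k ∈ VP P := by
    simp [M, Fintype.linearCombination_apply]
  have hlM : l ∈ M := by
    rw [hmem, ← funcOf_Pnat_sum Pk fun k => (hl k).le, ← hP, VP_eq_span]
    refine Submodule.subset_span ⟨0, Fin.elim0, ?_⟩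
    ext f
    rw [weightedShift_apply]
    congr 1
    ext x
    have : shiftN 0 x = x := rfl
    simp [cylIndicator, cylN, shiftC, this]
  have h := M.single_mem_of_separating
    (fun (p : Σ n : ℕ, Fin n → Δ) k => funcOf (Pnat (Pk k)) (cylIndicator p.2)) ?_
    (fun j k hjk => exists_funcOf_cylIndicator_ne (herg j).toMeasurePreserving
      (herg k).toMeasurePreserving (hinj.ne hjk)) hlM k
  · have hek : e k ∈ VP P := by
      have := (VP P).smul_mem (l k)⁻¹ (hmem.1 h)
      simpa [Pi.single_apply, ite_smul, smul_smul, inv_mul_cancel₀ (hl k).ne'] using this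
    rw [VP_eq_span, Submodule.span_le]
    rintro _ ⟨m, w, rfl⟩
    exact weightedShift_cylIndicator_mem_VP P w hek
  · rintro ⟨m, w⟩ c hc
    rw [hmem] at hc ⊢
    let u (N : ℕ) : C(ℕ → Δ, ℝ) → ℝ := (N : ℝ)⁻¹ • ∑ i ∈ Finset.range N,
      weightedShift 1 i (weightedShift (cylIndicator w) m (∑ k, c k • e k))
    have hu (N : ℕ) : u N ∈ VP P := (VP P).smul_mem _ <| sum_mem fun i _ =>
      weightedShift_one_mem_VP P i (weightedShift_cylIndicator_mem_VP P w hc)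
    refine (VP P).closed_of_finiteDimensional.mem_of_tendsto (f := u) (b := atTop) ?_
      (Eventually.of_forall hu)
    rw [tendsto_pi_nhds]
    intro f
    have hlim := tendsto_finsetSum Finset.univ fun k _ =>
      (tendsto_average_funcOf_Pnat (herg k) (f.comp (shiftC m)) (cylIndicator w)).const_mul (c k)
    simp only [funcOf_Pnat_comp_shiftC (herg _).toMeasurePreserving] at hlim
    convert hlim using 2 with N
    · simp only [u, e, Pi.smul_apply, Finset.sum_apply, weightedShift_apply, smul_eq_mul,
        Finset.mul_sum]
      rw [Finset.sum_comm]
      refine Finset.sum_congr rfl fun k _ => Finset.sum_congr rfl fun i _ => ?_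
      rw [mul_left_comm, one_mul, ContinuousMap.comp_assoc, shiftC_comp, add_comm, ← shiftC_comp]
      rfl
    · simp [e, mul_left_comm, mul_assoc]

theorem rank_pi_fin_eq_sum {K : Type*} [Field K] {n : ℕ} (V : Fin n → Type*)
    [∀ k, AddCommGroup (V k)] [∀ k, Module K (V k)] :
    Module.rank K (∀ k, V k) = ∑ k, Module.rank K (V k) := by
  induction n with
  | zero => simp
  | succ n ih =>
    rw [← (Fin.consLinearEquiv K V).rank_eq, rank_prod', ih, Fin.sum_univ_succ]

/-- If `P = Σ λ_k P_k` is a convex combination of finitely many distinct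
ergodic measures with strictly positive weights, then the process dimension of `P` is the
sum of the process dimensions of the `P_k`:
`dim(P) = Σ dim(P_k)` (dimensions of the canonical OOM vector spaces). -/
theorem stmt12 {n : ℕ} (Pk : Fin n → Measure (ℤ → Δ)) [∀ k, IsProbabilityMeasure (Pk k)]
    (herg : ∀ k, Ergodic (shiftZ (Δ := Δ)) (Pk k)) (hinj : Function.Injective Pk)
    (l : Fin n → ℝ) (hl : ∀ k, 0 < l k) (hsum : ∑ k, l k = 1)
    (P : Measure (ℤ → Δ)) (hP : P = ∑ k, ENNReal.ofReal (l k) • Pk k) :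
    Module.rank ℝ (VP P) = ∑ k, Module.rank ℝ (VP (Pk k)) := by
  have hPfin : IsFiniteMeasure P := by
    rw [hP]
    have (k : Fin n) : IsFiniteMeasure (ENNReal.ofReal (l k) • Pk k) :=
      (Pk k).smul_finite ENNReal.ofReal_ne_top
    infer_instance
  let Φ : (∀ k, VP (Pk k)) →ₗ[ℝ] (C((ℕ → Δ), ℝ) → ℝ) :=
    ∑ k, (VP (Pk k)).subtype ∘ₗ LinearMap.proj k
  have hΦ (v) : Φ v = ∑ k, (v k : C((ℕ → Δ), ℝ) → ℝ) := by simp [Φ]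
  have hΦinj : Function.Injective Φ := by
    rw [← LinearMap.ker_eq_bot, LinearMap.ker_eq_bot']
    intro v hv
    rw [hΦ] at hv
    have := eq_zero_of_sum_eq_zero_of_mem_VP herg hinj (fun k => (v k).2) hv
    ext1 k
    exact Subtype.ext (congrFun this k)
  have hle : VP P ≤ LinearMap.range Φ := by
    rw [VP_eq_span, Submodule.span_le]
    rintro _ ⟨m, w, rfl⟩
    have hmem (k : Fin n) : weightedShift (cylIndicator w) m (funcOf (Pnat (Pk k))) ∈ VP (Pk k) :=
      VP_eq_span (Pk k) ▸ Submodule.subset_span ⟨m, w, rfl⟩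
    refine ⟨fun k => l k • ⟨_, hmem k⟩, ?_⟩
    simp [hΦ, hP, funcOf_Pnat_sum Pk fun k => (hl k).le]
  have hrank : Module.rank ℝ (LinearMap.range Φ) = ∑ k, Module.rank ℝ (VP (Pk k)) := by
    rw [← (LinearEquiv.ofInjective Φ hΦinj).rank_eq, rank_pi_fin_eq_sum]
  rw [← hrank]
  refine le_antisymm (Submodule.rank_mono hle) ?_
  by_cases hfin : FiniteDimensional ℝ (VP P)
  · refine Submodule.rank_mono ?_
    rintro _ ⟨v, rfl⟩
    rw [hΦ]
    exact sum_mem fun k _ => VP_le_VP_of_finiteDimensional herg hinj hl hP k (v k).2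
  · rw [hrank]
    refine le_trans ?_ (not_lt.1 (mt Module.rank_lt_aleph0_iff.1 hfin))
    exact Finset.sum_induction _ (· ≤ Cardinal.aleph0)
      (fun _ _ h₁ h₂ => Cardinal.add_le_aleph0.2 ⟨h₁, h₂⟩) zero_le fun k _ => rank_VP_le_aleph0 (Pk k)
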